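/- Let d ≥ 3 and m ≥ 1, and let π̂_m be the coarse-grained random walk kernel on ℤ^d whose steps are exits of simple random walk from Euclidean balls of random radius in [m, 2m] (averaged over a smooth density φ supported in (1,2)). Then there exist constants c_1, c_2 > 0 depending only on d such that for all n ≥ 1 and all x ∈ ℤ^d with |x| ≥ 3m, the n-step transition probability satisfies π̂_m^n(0,x) ≤ c_1 m^{-d} exp(-|x|²/(c_2 n m²)). -/

import Mathlib

open MeasureTheory

/-- Euclidean norm of a lattice point in `ℤ^d`. -/
noncomputable def znorm {d : ℕ} (x : Fin d → ℤ) : ℝ := Real.sqrt (∑ i, ((x i : ℝ)) ^ 2)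

/-- A (time-homogeneous) Markov chain: a family of path-space laws `P x` which are
probability measures started at `x` and satisfy the Markov property. -/
def IsMarkovChain {S : Type*} [MeasurableSpace S]
    (P : S → Measure (ℕ → S)) : Prop :=
  (∀ x, IsProbabilityMeasure (P x)) ∧
  (∀ x, P x {ω | ω 0 = x} = 1) ∧
  (∀ (x : S) (n : ℕ) (A B : Set (ℕ → S)), MeasurableSet A → MeasurableSet B →
    (∀ ω ω' : ℕ → S, (∀ k ≤ n, ω k = ω' k) → (ω ∈ A ↔ ω' ∈ A)) →
    P x (A ∩ {ω | (fun k => ω (n + k)) ∈ B}) = ∫⁻ ω in A, P (ω n) B ∂(P x))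

/-- Simple random walk on `ℤ^d`: a Markov chain whose one-step law from `x` is uniform
on the `2d` nearest neighbours of `x`. -/
def IsSRW (d : ℕ) (P : (Fin d → ℤ) → Measure (ℕ → Fin d → ℤ)) : Prop :=
  IsMarkovChain P ∧
  ∀ x y : Fin d → ℤ,
    P x {ω | ω 1 = y} = if znorm (y - x) = 1 then ENNReal.ofReal (1 / (2 * d)) else 0

theorem exists_one_add_rpow_le_quartic (β : ℝ) :
    ∃ C > (0 : ℝ), ∃ δ > (0 : ℝ), ∀ u : ℝ, |u| < δ →
      (1 + u) ^ β ≤ 1 + β * u + β * (β - 1) / 2 * u ^ 2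
        + β * (β - 1) * (β - 2) / 6 * u ^ 3 + C * u ^ 4 := by
  have h := (Real.one_add_rpow_hasFPowerSeriesAt_zero (a := β)).isBigO_sub_partialSum_pow 4
  obtain ⟨C, hC, hb⟩ := h.exists_pos
  obtain ⟨δ, hδ, hball⟩ := Metric.eventually_nhds_iff.1 hb.bound
  refine ⟨C, hC, δ, hδ, fun u hu => ?_⟩
  have key := hball (y := u) (by simpa [Real.dist_eq] using hu)
  have e2 : Ring.choose β 2 = β * (β - 1) / 2 := by
    rw [Ring.choose_eq_smul]
    simp [Nat.factorial, descPochhammer_succ_right, Polynomial.smeval_mul, Polynomial.smeval_sub,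
      Polynomial.smeval_X, Polynomial.smeval_one]
    ring
  have two_eval : (2 : Polynomial ℤ).smeval β = 2 := by
    have := Polynomial.smeval_natCast ℤ β 2
    simpa using this
  have e3 : Ring.choose β 3 = β * (β - 1) * (β - 2) / 6 := by
    rw [Ring.choose_eq_smul]
    simp [Nat.factorial, descPochhammer_succ_right, Polynomial.smeval_mul, Polynomial.smeval_sub,
      Polynomial.smeval_X, Polynomial.smeval_one, two_eval]
    ring
  simp only [FormalMultilinearSeries.partialSum, binomialSeries, Finset.sum_range_succ,
    Finset.sum_range_zero] at key
  simp [e2, e3, FormalMultilinearSeries.ofScalars] at key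
  have := (abs_le.1 key).2
  have h4 : |u| ^ 4 = u ^ 4 := by rw [Even.pow_abs (by decide)]
  rw [h4] at this
  linarith

theorem exists_superharmonic_shift {d : ℕ} (hd : 3 ≤ d) :
    ∃ c : ℝ, 1 ≤ c ∧ ∀ y : Fin d → ℝ,
      ∑ i, (((∑ j, y j ^ 2) + c + 1 + 2 * y i) ^ (-((d : ℝ) - 2) / 2)
        + ((∑ j, y j ^ 2) + c + 1 - 2 * y i) ^ (-((d : ℝ) - 2) / 2))
        ≤ 2 * d * ((∑ j, y j ^ 2) + c) ^ (-((d : ℝ) - 2) / 2) := by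
  have hd' : (3 : ℝ) ≤ d := by exact_mod_cast hd
  set α : ℝ := ((d : ℝ) - 2) / 2 with hα
  have hα0 : 0 < α := by rw [hα]; linarith
  obtain ⟨C, hC, δ, hδ, hT⟩ := exists_one_add_rpow_le_quartic (-α)
  refine ⟨1 + 9 / δ ^ 2 + d + 324 * C / α, ?_, fun y => ?_⟩
  · have : 0 ≤ 9 / δ ^ 2 + d + 324 * C / α := by positivity
    linarith
  have hneg : -((d : ℝ) - 2) / 2 = -α := by rw [hα]; ring
  rw [hneg]
  set c : ℝ := 1 + 9 / δ ^ 2 + d + 324 * C / α with hc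
  have h9 : 0 < 9 / δ ^ 2 := by positivity
  have hCα : 0 < 324 * C / α := by positivity
  set S : ℝ := ∑ j, y j ^ 2 with hS
  have hS0 : 0 ≤ S := Finset.sum_nonneg fun i _ => sq_nonneg _
  set R : ℝ := S + c with hR
  have hRc : c ≤ R := by linarith
  have hR1 : 1 ≤ R := by linarith
  have hR0 : 0 < R := by linarith
  have hyR : ∀ i, y i ^ 2 ≤ R := fun i => by
    have := Finset.single_le_sum (f := fun j => y j ^ 2) (fun j _ => sq_nonneg _) (Finset.mem_univ i)
    linarith
  have hsq : Real.sqrt R ^ 2 = R := Real.sq_sqrt hR0.le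
  have hs1 : 1 ≤ Real.sqrt R := Real.one_le_sqrt.2 hR1
  have hsδ : 3 / Real.sqrt R < δ := by
    rw [div_lt_iff₀ (by linarith)]
    have : 9 / δ ^ 2 < R := by linarith
    rw [div_lt_iff₀ (by positivity), ← hsq] at this
    nlinarith [mul_pos hδ (show (0:ℝ) < Real.sqrt R by linarith)]
  have hu : ∀ v : ℝ, v ^ 2 ≤ R → |(1 + 2 * v) / R| ≤ 3 / Real.sqrt R := fun v hv => by
    rw [abs_div, abs_of_pos hR0, div_le_div_iff₀ hR0 (by linarith)]
    have hv' : |v| ≤ Real.sqrt R := Real.abs_le_sqrt hv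
    have : |1 + 2 * v| ≤ 3 * Real.sqrt R := by
      rw [abs_le] at hv' ⊢
      constructor <;> linarith
    nlinarith [abs_nonneg (1 + 2 * v)]
  have hu4 : ∀ v : ℝ, v ^ 2 ≤ R → ((1 + 2 * v) / R) ^ 4 ≤ 81 / R ^ 2 := fun v hv => by
    have h := pow_le_pow_left₀ (abs_nonneg _) (hu v hv) 4
    rw [Even.pow_abs (by decide), div_pow 3] at h
    have : Real.sqrt R ^ 4 = R ^ 2 := by rw [← hsq]; ring_nf; rw [hsq]
    rw [this] at h
    linarith
  have hfac : ∀ v : ℝ, v ^ 2 ≤ R → (R + 1 + 2 * v) ^ (-α) = R ^ (-α) * (1 + (1 + 2 * v) / R) ^ (-α) :=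
    fun v hv => by
      have hpos : 0 ≤ 1 + (1 + 2 * v) / R := by
        have : 0 ≤ R + 1 + 2 * v := by nlinarith [sq_nonneg (v + 1)]
        have e : 1 + (1 + 2 * v) / R = (R + 1 + 2 * v) / R := by field_simp; ring
        rw [e]; positivity
      rw [← Real.mul_rpow hR0.le hpos]
      congr 1
      field_simp
      ring
  have hcoord : ∀ i, (R + 1 + 2 * y i) ^ (-α) + (R + 1 - 2 * y i) ^ (-α) ≤
      R ^ (-α) * (2 - 2 * α / R + α * (α + 1) * (1 + 4 * y i ^ 2) / R ^ 2 + 162 * C / R ^ 2) := by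
    intro i
    have hv := hyR i
    have hv' : (-y i) ^ 2 ≤ R := by rw [neg_sq]; exact hv
    have e : R + 1 - 2 * y i = R + 1 + 2 * (-y i) := by ring
    rw [e, hfac _ hv, hfac _ hv', ← mul_add]
    refine mul_le_mul_of_nonneg_left ?_ (Real.rpow_nonneg hR0.le _)
    have t1 := hT _ ((hu _ hv).trans_lt hsδ)
    have t2 := hT _ ((hu _ hv').trans_lt hsδ)
    have f1 := mul_le_mul_of_nonneg_left (hu4 _ hv) hC.le
    have f2 := mul_le_mul_of_nonneg_left (hu4 _ hv') hC.le
    have cube : 0 ≤ α * (α + 1) * (α + 2) / 6 *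
        (((1 + 2 * y i) / R) ^ 3 + ((1 + 2 * -y i) / R) ^ 3) := by
      have : ((1 + 2 * y i) / R) ^ 3 + ((1 + 2 * -y i) / R) ^ 3 = (2 + 24 * y i ^ 2) / R ^ 3 := by
        field_simp; ring
      rw [this]; positivity
    have sq : ((1 + 2 * y i) / R) ^ 2 + ((1 + 2 * -y i) / R) ^ 2 = 2 * ((1 + 4 * y i ^ 2) / R ^ 2) := by
      field_simp; ring
    have li : (1 + 2 * y i) / R + (1 + 2 * -y i) / R = 2 / R := by
      field_simp; ring
    have e1 : 2 * α / R = α * (2 / R) := by ring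
    have e2 : α * (α + 1) * (1 + 4 * y i ^ 2) / R ^ 2
      = α * (α + 1) / 2 * (2 * ((1 + 4 * y i ^ 2) / R ^ 2)) := by ring
    have e3 : 162 * C / R ^ 2 = C * (81 / R ^ 2) + C * (81 / R ^ 2) := by ring
    rw [e1, e2, e3, ← li, ← sq]
    linarith
  refine (Finset.sum_le_sum fun i _ => hcoord i).trans ?_
  rw [← Finset.mul_sum, mul_comm (2 * (d : ℝ))]
  refine mul_le_mul_of_nonneg_left ?_ (Real.rpow_nonneg hR0.le _)
  have hsum : ∑ i, (2 - 2 * α / R + α * (α + 1) * (1 + 4 * y i ^ 2) / R ^ 2 + 162 * C / R ^ 2)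
      = d * (2 - 2 * α / R + 162 * C / R ^ 2) + α * (α + 1) * (d + 4 * S) / R ^ 2 := by
    have : ∀ i, 2 - 2 * α / R + α * (α + 1) * (1 + 4 * y i ^ 2) / R ^ 2 + 162 * C / R ^ 2
      = (2 - 2 * α / R + 162 * C / R ^ 2 + α * (α + 1) / R ^ 2)
        + (4 * α * (α + 1) / R ^ 2) * y i ^ 2 := fun i => by ring
    simp only [this]
    rw [Finset.sum_add_distrib, ← Finset.mul_sum, ← hS]
    simp
    ring
  rw [hsum]
  have hdα : (d : ℝ) = 2 * (α + 1) := by rw [hα]; ring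
  have hSR : S = R - c := by rw [hR]; ring
  have hdiff : d * (2 - 2 * α / R + 162 * C / R ^ 2) + α * (α + 1) * (d + 4 * S) / R ^ 2 - 2 * d
      = (α * (α + 1) * (d - 4 * c) + 162 * C * d) / R ^ 2 := by
    rw [hSR, hdα]; field_simp; ring
  have hnum : α * (α + 1) * (d - 4 * c) + 162 * C * d ≤ 0 := by
    have h1 : 324 * C / α ≤ 4 * c - d := by linarith
    rw [div_le_iff₀ hα0] at h1
    have h2 : 162 * C * (d : ℝ) = (α + 1) * (324 * C) := by rw [hdα]; ring
    rw [h2]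
    nlinarith
  have := div_nonpos_of_nonpos_of_nonneg hnum (sq_nonneg R)
  linarith

theorem rpow_neg_sub_rpow_neg_le {α a b : ℝ} (hα : 0 ≤ α) (ha : 0 < a) (hb : 0 < b) :
    a ^ (-α) - b ^ (-α) ≤ α * a ^ (-α - 1) * (b - a) := by
  have hlog : Real.log (b / a) ≤ b / a - 1 := Real.log_le_sub_one_of_pos (by positivity)
  have hexp : 1 - α * Real.log (b / a) ≤ (b / a) ^ (-α) := by
    rw [Real.rpow_def_of_pos (by positivity)]
    linarith [Real.add_one_le_exp (Real.log (b / a) * -α)]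
  have hb' : b ^ (-α) = a ^ (-α) * (b / a) ^ (-α) := by
    rw [← Real.mul_rpow ha.le (by positivity)]; congr 1; field_simp
  have ha' : a ^ (-α - 1) = a ^ (-α) / a := Real.rpow_sub_one ha.ne' _
  rw [hb', ha']
  have hpos := Real.rpow_pos_of_pos ha (-α)
  have e : α * (a ^ (-α) / a) * (b - a) = a ^ (-α) * (α * (b / a - 1)) := by field_simp
  rw [e]
  nlinarith [mul_le_mul_of_nonneg_left hlog hα]

theorem znorm_nonneg {d : ℕ} (x : Fin d → ℤ) : 0 ≤ znorm x := Real.sqrt_nonneg _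

theorem sq_znorm {d : ℕ} (x : Fin d → ℤ) : znorm x ^ 2 = ∑ i, (x i : ℝ) ^ 2 :=
  Real.sq_sqrt (Finset.sum_nonneg fun _ _ => sq_nonneg _)

theorem znorm_zero {d : ℕ} : znorm (0 : Fin d → ℤ) = 0 := by simp [znorm]

theorem znorm_neg {d : ℕ} (x : Fin d → ℤ) : znorm (-x) = znorm x := by simp [znorm]

theorem sum_mul_le_znorm_mul {d : ℕ} (x y : Fin d → ℤ) :
    ∑ i, (x i : ℝ) * y i ≤ znorm x * znorm y :=
  Real.sum_mul_le_sqrt_mul_sqrt _ _ _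

theorem znorm_add_le {d : ℕ} (x y : Fin d → ℤ) : znorm (x + y) ≤ znorm x + znorm y := by
  refine abs_le_of_sq_le_sq' ?_ (add_nonneg (znorm_nonneg x) (znorm_nonneg y)) |>.2
  have e : znorm (x + y) ^ 2 = znorm x ^ 2 + 2 * ∑ i, (x i : ℝ) * y i + znorm y ^ 2 := by
    simp only [sq_znorm, Pi.add_apply, Int.cast_add, Finset.mul_sum, ← Finset.sum_add_distrib]
    exact Finset.sum_congr rfl fun i _ => by ring
  rw [e]
  linarith [sum_mul_le_znorm_mul x y]

theorem sq_znorm_add_single {d : ℕ} (y : Fin d → ℤ) (i : Fin d) :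
    znorm (y + Pi.single i 1) ^ 2 = znorm y ^ 2 + 1 + 2 * y i := by
  rw [sq_znorm, sq_znorm, ← Finset.add_sum_erase _ _ (Finset.mem_univ i),
    ← Finset.add_sum_erase _ (fun j => (y j : ℝ) ^ 2) (Finset.mem_univ i)]
  have : ∑ j ∈ Finset.univ.erase i, (((y + Pi.single i 1 : Fin d → ℤ) j : ℤ) : ℝ) ^ 2
      = ∑ j ∈ Finset.univ.erase i, (y j : ℝ) ^ 2 :=
    Finset.sum_congr rfl fun j hj => by
      simp [Pi.single_eq_of_ne (Finset.ne_of_mem_erase hj)]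
  rw [this]
  simp only [Pi.add_apply, Pi.single_eq_same, Int.cast_add, Int.cast_one]
  ring

theorem sq_znorm_sub_single {d : ℕ} (y : Fin d → ℤ) (i : Fin d) :
    znorm (y - Pi.single i 1) ^ 2 = znorm y ^ 2 + 1 - 2 * y i := by
  have h := sq_znorm_add_single (-y) i
  rw [znorm_neg, show -y + Pi.single i 1 = -(y - Pi.single i 1) by abel, znorm_neg] at h
  rw [h]
  push_cast [Pi.neg_apply]
  ring

theorem znorm_single {d : ℕ} (i : Fin d) : znorm (Pi.single i 1 : Fin d → ℤ) = 1 := by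
  have h := sq_znorm_add_single (0 : Fin d → ℤ) i
  simp only [zero_add, znorm_zero, Pi.zero_apply, Int.cast_zero] at h
  nlinarith [znorm_nonneg (Pi.single i 1 : Fin d → ℤ)]

theorem exists_single_of_znorm_eq_one {d : ℕ} {v : Fin d → ℤ} (hv : znorm v = 1) :
    ∃ i, v = Pi.single i 1 ∨ v = -Pi.single i 1 := by
  have hsum : ∑ i, v i ^ 2 = 1 := by
    have h := sq_znorm v
    rw [hv] at h
    have : (1 : ℝ) = ((∑ i, v i ^ 2 : ℤ) : ℝ) := by push_cast; linarith
    exact_mod_cast this.symm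
  obtain ⟨i, hi⟩ : ∃ i, v i ≠ 0 := by
    by_contra! h
    simp [h] at hsum
  have hdec := Finset.add_sum_erase Finset.univ (fun j => v j ^ 2) (Finset.mem_univ i)
  simp only [hsum] at hdec
  have hrest : 0 ≤ ∑ j ∈ Finset.univ.erase i, v j ^ 2 := Finset.sum_nonneg fun _ _ => sq_nonneg _
  have hi1 : 0 < v i ^ 2 := by positivity
  have hrest0 : ∑ j ∈ Finset.univ.erase i, v j ^ 2 = 0 := by lia
  have hone : v i ^ 2 = 1 := by lia
  have hzero : ∀ j, j ≠ i → v j = 0 := fun j hj => by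
    have := (Finset.sum_eq_zero_iff_of_nonneg fun _ _ => sq_nonneg _).1 hrest0 j (by simp [hj])
    exact pow_eq_zero_iff (two_ne_zero) |>.1 this
  refine ⟨i, (mul_self_eq_one_iff.1 ((sq _).symm.trans hone)).imp (fun h => ?_) fun h => ?_⟩ <;>
  · funext j
    by_cases hj : j = i
    · subst hj; simp [h]
    · simp [hj, hzero j hj]

theorem exists_barrier {d : ℕ} (hd : 3 ≤ d) :
    ∃ C > (0 : ℝ), ∀ t : ℝ, 1 ≤ t → ∃ g : (Fin d → ℤ) → ℝ,
      (∀ y, znorm y ≤ t + 1 → 0 ≤ g y) ∧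
      (∀ y, t - 1 ≤ znorm y → g y ≤ C * t ^ (1 - (d : ℝ))) ∧
      ∀ y, (if y = 0 then 1 else 0)
        + 1 / (2 * d) * ∑ i, (g (y + Pi.single i 1) + g (y - Pi.single i 1)) ≤ g y := by
  have hd' : (3 : ℝ) ≤ d := by exact_mod_cast hd
  obtain ⟨c, hc, hsup⟩ := exists_superharmonic_shift hd
  have hneg : -((d : ℝ) - 2) / 2 = -(((d : ℝ) - 2) / 2) := by ring
  rw [hneg] at hsup
  set α : ℝ := ((d : ℝ) - 2) / 2 with hα
  have hα0 : 0 < α := by rw [hα]; linarith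
  have hgap : 0 < c ^ (-α) - (c + 1) ^ (-α) :=
    sub_pos.2 (Real.rpow_lt_rpow_of_neg (by linarith) (by linarith) (by linarith))
  set A : ℝ := (c ^ (-α) - (c + 1) ^ (-α))⁻¹ with hA
  have hA0 : 0 < A := inv_pos.2 hgap
  refine ⟨A * (α * 2 ^ (α + 1) * 4), by positivity, fun t ht => ?_⟩
  set H : ℝ := ((t + 1) ^ 2 + c) ^ (-α) with hH
  refine ⟨fun y => A * ((znorm y ^ 2 + c) ^ (-α) - H), fun y hy => ?_, fun y hy => ?_, fun y => ?_⟩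
  · refine mul_nonneg hA0.le (sub_nonneg.2 ?_)
    refine Real.rpow_le_rpow_of_nonpos (by positivity) ?_ (by linarith)
    have := pow_le_pow_left₀ (znorm_nonneg y) hy 2
    linarith
  · rw [mul_assoc A]
    refine mul_le_mul_of_nonneg_left ?_ hA0.le
    have hlow : (t - 1) ^ 2 ≤ znorm y ^ 2 := pow_le_pow_left₀ (by linarith) hy 2
    have ha : 0 < (t - 1) ^ 2 + c := by positivity
    have h1 : (znorm y ^ 2 + c) ^ (-α) ≤ ((t - 1) ^ 2 + c) ^ (-α) :=
      Real.rpow_le_rpow_of_nonpos ha (by linarith) (by linarith)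
    have h2 := rpow_neg_sub_rpow_neg_le (b := (t + 1) ^ 2 + c) hα0.le ha (by positivity)
    have h3 : ((t - 1) ^ 2 + c) ^ (-α - 1) ≤ (t ^ 2 / 2) ^ (-α - 1) :=
      Real.rpow_le_rpow_of_nonpos (by positivity) (by nlinarith [sq_nonneg (t - 2)]) (by linarith)
    have ht0 : 0 < t := by linarith
    have h4 : (t ^ 2 / 2) ^ (-α - 1) * t = 2 ^ (α + 1) * t ^ (1 - (d : ℝ)) := by
      rw [Real.div_rpow (by positivity) (by norm_num), ← Real.rpow_natCast t 2,
        ← Real.rpow_mul ht0.le, div_eq_mul_inv, ← Real.rpow_neg (by norm_num),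
        mul_comm (t ^ _) _, mul_assoc, ← Real.rpow_add_one ht0.ne']
      congr 2
      · ring
      · push_cast; rw [hα]; ring
    calc (znorm y ^ 2 + c) ^ (-α) - H ≤ α * ((t - 1) ^ 2 + c) ^ (-α - 1) * (4 * t) := by
          have e : (t + 1) ^ 2 + c - ((t - 1) ^ 2 + c) = 4 * t := by ring
          rw [e] at h2
          linarith
      _ ≤ α * (t ^ 2 / 2) ^ (-α - 1) * (4 * t) := by gcongr
      _ = α * 4 * ((t ^ 2 / 2) ^ (-α - 1) * t) := by ring
      _ = _ := by rw [h4]; ring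
  · have key := hsup fun i => (y i : ℝ)
    simp only [← sq_znorm] at key
    have hsum : ∑ i, (A * ((znorm (y + Pi.single i 1) ^ 2 + c) ^ (-α) - H)
        + A * ((znorm (y - Pi.single i 1) ^ 2 + c) ^ (-α) - H))
        = A * (∑ i, ((znorm y ^ 2 + c + 1 + 2 * y i) ^ (-α)
          + (znorm y ^ 2 + c + 1 - 2 * y i) ^ (-α)) - 2 * d * H) := by
      have : 2 * (d : ℝ) * H = ∑ _i : Fin d, 2 * H := by simp; ring
      rw [this, ← Finset.sum_sub_distrib, Finset.mul_sum]
      refine Finset.sum_congr rfl fun i _ => ?_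
      rw [sq_znorm_add_single, sq_znorm_sub_single]
      ring_nf
    rw [hsum]
    have hd0 : (0 : ℝ) < d := by linarith
    by_cases hy : y = 0
    · subst hy
      have hAg : A * (c ^ (-α) - (c + 1) ^ (-α)) = 1 := inv_mul_cancel₀ hgap.ne'
      simp only [znorm_zero, if_true, Pi.zero_apply, Int.cast_zero, mul_zero, add_zero, sub_zero,
        Finset.sum_const, Finset.card_univ, Fintype.card_fin, nsmul_eq_mul, ne_eq, OfNat.ofNat_ne_zero,
        not_false_eq_true, zero_pow, zero_add]
      have e : 1 / (2 * (d : ℝ)) * (A * (d * ((c + 1) ^ (-α) + (c + 1) ^ (-α)) - 2 * d * H))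
        = A * ((c + 1) ^ (-α) - H) := by field_simp; ring
      rw [e]
      linarith
    · rw [if_neg hy, zero_add]
      have e : A * ((znorm y ^ 2 + c) ^ (-α) - H)
        = 1 / (2 * (d : ℝ)) * (A * (2 * d * (znorm y ^ 2 + c) ^ (-α) - 2 * d * H)) := by
        field_simp
      exact (by gcongr : _ ≤ _).trans_eq e.symm

/-- The one-step law of simple random walk on `ℤ^d` started at the origin. -/
noncomputable def srwStep {d : ℕ} (v : Fin d → ℤ) : ENNReal :=
  if znorm v = 1 then ENNReal.ofReal (1 / (2 * d)) else 0

/-- The law at time `n` of simple random walk from the origin, killed on leaving the Euclidean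
ball of radius `t`. -/
noncomputable def killedLaw {d : ℕ} (t : ℝ) : ℕ → (Fin d → ℤ) → ENNReal
  | 0, y => if y = 0 then 1 else 0
  | n + 1, y => if znorm y ≤ t then ∑' w, killedLaw t n w * srwStep (y - w) else 0

/-- The law of the exit point of simple random walk from the Euclidean ball of radius `t`
around its starting point, the origin. -/
noncomputable def exitLaw {d : ℕ} (t : ℝ) (z : Fin d → ℤ) : ENNReal :=
  if t < znorm z then ∑' n, ∑' w, killedLaw t n w * srwStep (z - w) else 0

theorem srwStep_neg {d : ℕ} (v : Fin d → ℤ) : srwStep (-v) = srwStep v := by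
  simp [srwStep, znorm_neg]

theorem killedLaw_neg {d : ℕ} (t : ℝ) (n : ℕ) (y : Fin d → ℤ) :
    killedLaw t n (-y) = killedLaw t n y := by
  induction n generalizing y with
  | zero => simp [killedLaw]
  | succ n ih =>
    simp only [killedLaw, znorm_neg]
    congr 1
    rw [← (Equiv.neg (Fin d → ℤ)).tsum_eq]
    refine tsum_congr fun w => ?_
    rw [Equiv.neg_apply, ih, ← srwStep_neg (y - w)]
    congr 2
    abel

theorem exitLaw_neg {d : ℕ} (t : ℝ) (z : Fin d → ℤ) : exitLaw t (-z) = exitLaw t z := by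
  simp only [exitLaw, znorm_neg]
  congr 1
  refine tsum_congr fun n => ?_
  rw [← (Equiv.neg (Fin d → ℤ)).tsum_eq]
  refine tsum_congr fun w => ?_
  rw [Equiv.neg_apply, killedLaw_neg, ← srwStep_neg (z - w)]
  congr 2
  abel

theorem tsum_mul_srwStep_le {d : ℕ} (F : (Fin d → ℤ) → ENNReal) (y : Fin d → ℤ) :
    ∑' w, F w * srwStep (y - w)
      ≤ ENNReal.ofReal (1 / (2 * d)) *
        ∑ i, (F (y + Pi.single i 1) + F (y - Pi.single i 1)) := by
  classical
  have hpt : ∀ w, F w * srwStep (y - w) ≤ ∑ i, (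
      (if w = y + Pi.single i 1 then ENNReal.ofReal (1 / (2 * d)) * F w else 0)
        + (if w = y - Pi.single i 1 then ENNReal.ofReal (1 / (2 * d)) * F w else 0)) := by
    intro w
    by_cases h : znorm (y - w) = 1
    · rw [srwStep, if_pos h, mul_comm]
      obtain ⟨i, hi | hi⟩ := exists_single_of_znorm_eq_one h
      · have hw : w = y - Pi.single i 1 := by rw [← hi]; abel
        refine le_trans ?_ (Finset.single_le_sum (fun _ _ => zero_le) (Finset.mem_univ i))
        rw [if_pos hw]
        exact le_add_self
      · have hw : w = y + Pi.single i 1 := by rw [← neg_neg (Pi.single i 1), ← hi]; abel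
        refine le_trans ?_ (Finset.single_le_sum (fun _ _ => zero_le) (Finset.mem_univ i))
        rw [if_pos hw]
        exact le_self_add
    · simp [srwStep, h]
  refine (ENNReal.tsum_le_tsum hpt).trans_eq ?_
  rw [Summable.tsum_finsetSum fun _ _ => ENNReal.summable, Finset.mul_sum]
  refine Finset.sum_congr rfl fun i _ => ?_
  rw [ENNReal.tsum_add, tsum_ite_eq, tsum_ite_eq, mul_add]

theorem tsum_srwStep_le_one {d : ℕ} (y : Fin d → ℤ) : ∑' w, srwStep (y - w) ≤ 1 := by
  have h := tsum_mul_srwStep_le (fun _ => 1) y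
  simp only [one_mul] at h
  refine h.trans ?_
  rw [← ENNReal.ofReal_one, ← ENNReal.ofReal_add zero_le_one zero_le_one,
    ← ENNReal.ofReal_sum_of_nonneg (by intros; norm_num), ← ENNReal.ofReal_mul (by positivity)]
  refine ENNReal.ofReal_le_ofReal ?_
  rcases Nat.eq_zero_or_pos d with rfl | hd
  · simp
  · have : (0 : ℝ) < d := by exact_mod_cast hd
    simp
    field_simp
    norm_num

theorem killedLaw_eq_zero {d : ℕ} {t : ℝ} (ht : 0 ≤ t) {n : ℕ} {y : Fin d → ℤ}
    (hy : t < znorm y) : killedLaw t n y = 0 := by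
  cases n with
  | zero =>
    have : y ≠ 0 := by rintro rfl; rw [znorm_zero] at hy; linarith
    simp [killedLaw, this]
  | succ n => simp [killedLaw, hy.not_ge]

theorem sum_range_killedLaw_le {d : ℕ} {t : ℝ} (ht : 0 ≤ t) {g : (Fin d → ℤ) → ℝ}
    (hg0 : ∀ y, znorm y ≤ t + 1 → 0 ≤ g y)
    (hg : ∀ y, (if y = 0 then 1 else 0)
        + 1 / (2 * d) * ∑ i, (g (y + Pi.single i 1) + g (y - Pi.single i 1)) ≤ g y)
    (N : ℕ) (y : Fin d → ℤ) :
    ∑ n ∈ Finset.range N, killedLaw t n y ≤ ENNReal.ofReal (g y) := by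
  classical
  induction N generalizing y with
  | zero => simp
  | succ N ih =>
    by_cases hy : znorm y ≤ t
    · have hplus : ∀ i, 0 ≤ g (y + Pi.single i 1) := fun i => hg0 _ <| by
        linarith [znorm_add_le y (Pi.single i 1), znorm_single i]
      have hminus : ∀ i, 0 ≤ g (y - Pi.single i 1) := fun i => hg0 _ <| by
        have := znorm_add_le y (-Pi.single i 1)
        rw [znorm_neg, ← sub_eq_add_neg] at this
        linarith [znorm_single i]
      rw [Finset.sum_range_succ']
      simp only [killedLaw, if_pos hy]
      rw [← Summable.tsum_finsetSum fun _ _ => ENNReal.summable]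
      simp only [← Finset.sum_mul]
      calc _ ≤ ENNReal.ofReal (1 / (2 * d)) * ∑ i, (ENNReal.ofReal (g (y + Pi.single i 1))
              + ENNReal.ofReal (g (y - Pi.single i 1))) + ENNReal.ofReal (if y = 0 then 1 else 0) := by
            gcongr
            · refine (ENNReal.tsum_le_tsum fun w => ?_).trans
                (tsum_mul_srwStep_le (fun w => ENNReal.ofReal (g w)) y)
              exact mul_le_mul_left (ih w) _
            · split_ifs <;> simp
        _ = ENNReal.ofReal (1 / (2 * d) * ∑ i, (g (y + Pi.single i 1) + g (y - Pi.single i 1))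
              + (if y = 0 then 1 else 0)) := by
            have hs : ∀ i, 0 ≤ g (y + Pi.single i 1) + g (y - Pi.single i 1) :=
              fun i => add_nonneg (hplus i) (hminus i)
            rw [ENNReal.ofReal_add (mul_nonneg (by positivity) (Finset.sum_nonneg fun i _ => hs i))
              (by split_ifs <;> norm_num), ENNReal.ofReal_mul (by positivity),
              ENNReal.ofReal_sum_of_nonneg fun i _ => hs i]
            congr 2
            exact Finset.sum_congr rfl fun i _ => (ENNReal.ofReal_add (hplus i) (hminus i)).symm
        _ ≤ _ := ENNReal.ofReal_le_ofReal (by have := hg y; simp only [add_comm] at this ⊢; exact this)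
    · simp [killedLaw_eq_zero ht (not_le.1 hy)]

theorem exists_exitLaw_le {d : ℕ} (hd : 3 ≤ d) :
    ∃ C > (0 : ℝ), ∀ t : ℝ, 1 ≤ t → ∀ z : Fin d → ℤ,
      exitLaw t z ≤ ENNReal.ofReal (C * t ^ (1 - (d : ℝ))) := by
  obtain ⟨C, hC, hbar⟩ := exists_barrier hd
  refine ⟨C, hC, fun t ht z => ?_⟩
  obtain ⟨g, hg0, hgC, hg⟩ := hbar t ht
  rw [exitLaw]
  split_ifs with hz
  swap
  · exact zero_le
  rw [ENNReal.tsum_comm]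
  calc ∑' w, ∑' n, killedLaw t n w * srwStep (z - w)
      ≤ ∑' w, ENNReal.ofReal (C * t ^ (1 - (d : ℝ))) * srwStep (z - w) := by
        refine ENNReal.tsum_le_tsum fun w => ?_
        rw [ENNReal.tsum_mul_right]
        by_cases hw : znorm (z - w) = 1
        · refine mul_le_mul_left ?_ _
          refine (ENNReal.tsum_le_of_sum_range_le (sum_range_killedLaw_le (by linarith) hg0 hg · w)).trans
            (ENNReal.ofReal_le_ofReal (hgC w ?_))
          have := znorm_add_le (z - w) w
          rw [sub_add_cancel] at this
          linarith
        · simp [srwStep, hw]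
    _ = ENNReal.ofReal (C * t ^ (1 - (d : ℝ))) * ∑' w, srwStep (z - w) := ENNReal.tsum_mul_left
    _ ≤ _ := mul_le_of_le_one_right (zero_le) (tsum_srwStep_le_one z)

theorem exitLaw_eq_zero {d : ℕ} {t : ℝ} (ht : 0 ≤ t) {z : Fin d → ℤ}
    (hz : ¬ (t < znorm z ∧ znorm z ≤ t + 1)) : exitLaw t z = 0 := by
  rw [exitLaw]
  split_ifs with h
  · refine ENNReal.tsum_eq_zero.2 fun n => ENNReal.tsum_eq_zero.2 fun w => ?_
    by_cases hw : znorm (z - w) = 1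
    · have := znorm_add_le (z - w) w
      rw [sub_add_cancel] at this
      have hzt : ¬ znorm z ≤ t + 1 := fun h' => hz ⟨h, h'⟩
      rw [killedLaw_eq_zero ht (by linarith), zero_mul]
    · simp [srwStep, hw]
  · rfl

theorem measurableSet_path_eq {S : Type*} [MeasurableSpace S] [MeasurableSingletonClass S]
    (n : ℕ) (z : S) : MeasurableSet {ω : ℕ → S | ω n = z} := by
  have h : MeasurableSet ((fun ω : ℕ → S => ω n) ⁻¹' {z}) :=
    (measurable_pi_apply n) (measurableSet_singleton z)
  exact h

theorem IsMarkovChain.ae_eq_start {S : Type*} [MeasurableSpace S] [MeasurableSingletonClass S]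
    {P : S → Measure (ℕ → S)} (hP : IsMarkovChain P) (x : S) : ∀ᵐ ω ∂P x, ω 0 = x := by
  have := hP.1 x
  exact (mem_ae_iff_prob_eq_one (measurableSet_path_eq 0 x)).2 (hP.2.1 x)

theorem IsMarkovChain.measure_inter_step {S : Type*} [MeasurableSpace S]
    [MeasurableSingletonClass S] {P : S → Measure (ℕ → S)} (hP : IsMarkovChain P) (x w z : S)
    {n : ℕ} {A : Set (ℕ → S)} (hA : MeasurableSet A) (hAw : ∀ ω ∈ A, ω n = w)
    (hAn : ∀ ω ω' : ℕ → S, (∀ k ≤ n, ω k = ω' k) → (ω ∈ A ↔ ω' ∈ A)) :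
    P x (A ∩ {ω | ω (n + 1) = z}) = P x A * P w {ω | ω 1 = z} := by
  have h := hP.2.2 x n A {ω | ω 1 = z} hA (measurableSet_path_eq 1 z) hAn
  simp only [Set.mem_ofPred_eq] at h
  rw [h, setLIntegral_congr_fun (g := fun _ => P w {ω | ω 1 = z}) hA
    (fun ω hω => by simp only [hAw ω hω]), setLIntegral_const, mul_comm]

theorem IsMarkovChain.measure_succ {S : Type*} [MeasurableSpace S] [Countable S]
    [MeasurableSingletonClass S] {P : S → Measure (ℕ → S)} (hP : IsMarkovChain P) (x z : S)
    (n : ℕ) :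
    P x {ω | ω (n + 1) = z} = ∑' w, P x {ω | ω n = w} * P w {ω | ω 1 = z} := by
  have hunion : {ω : ℕ → S | ω (n + 1) = z}
      = ⋃ w, ({ω | ω n = w} ∩ {ω | ω (n + 1) = z}) := by
    ext ω; simp
  rw [hunion, measure_iUnion]
  · refine tsum_congr fun w => ?_
    refine hP.measure_inter_step x w z (measurableSet_path_eq n w) (fun _ h => h)
      fun ω ω' h => ?_
    simp [h n le_rfl]
  · intro w w' hw
    refine Set.disjoint_left.2 fun ω h h' => hw ?_
    exact h.1.symm.trans h'.1
  · exact fun w => (measurableSet_path_eq n w).inter (measurableSet_path_eq _ z)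

theorem IsMarkovChain.measure_zero {S : Type*} [MeasurableSpace S] [MeasurableSingletonClass S]
    [DecidableEq S] {P : S → Measure (ℕ → S)} (hP : IsMarkovChain P) (x y : S) :
    P x {ω | ω 0 = y} = if y = x then 1 else 0 := by
  split_ifs with h
  · rw [h]; exact hP.2.1 x
  · refine measure_eq_zero_iff_ae_notMem.2 ?_
    filter_upwards [hP.ae_eq_start x] with ω hω hy
    exact h (hy.symm.trans hω)

theorem measurableSet_stay_eq {d : ℕ} (x y : Fin d → ℤ) (t : ℝ) (n : ℕ) :
    MeasurableSet {ω : ℕ → Fin d → ℤ | (∀ k ≤ n, znorm (ω k - x) ≤ t) ∧ ω n = y} := by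
  have h : {ω : ℕ → Fin d → ℤ | (∀ k ≤ n, znorm (ω k - x) ≤ t) ∧ ω n = y}
      = (⋂ k, ⋂ _ : k ≤ n, (fun ω : ℕ → Fin d → ℤ => ω k) ⁻¹' {v | znorm (v - x) ≤ t})
        ∩ {ω | ω n = y} := by
    ext ω; simp
  rw [h]
  exact (MeasurableSet.iInter fun k => MeasurableSet.iInter fun _ =>
    (measurable_pi_apply k) MeasurableSet.of_discrete).inter (measurableSet_path_eq n y)

theorem stay_eq_congr {d : ℕ} (x y : Fin d → ℤ) (t : ℝ) (n : ℕ) (ω ω' : ℕ → Fin d → ℤ)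
    (h : ∀ k ≤ n, ω k = ω' k) :
    (ω ∈ {ω : ℕ → Fin d → ℤ | (∀ k ≤ n, znorm (ω k - x) ≤ t) ∧ ω n = y} ↔
      ω' ∈ {ω : ℕ → Fin d → ℤ | (∀ k ≤ n, znorm (ω k - x) ≤ t) ∧ ω n = y}) := by
  simp only [Set.mem_ofPred_eq, h n le_rfl]
  exact and_congr_left fun _ => forall₂_congr fun k hk => by rw [h k hk]

theorem IsSRW.measure_stay_inter {d : ℕ} {P : (Fin d → ℤ) → Measure (ℕ → Fin d → ℤ)}
    (hP : IsSRW d P) (x w z : Fin d → ℤ) (t : ℝ) (n : ℕ) :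
    P x ({ω | (∀ k ≤ n, znorm (ω k - x) ≤ t) ∧ ω n = w} ∩ {ω | ω (n + 1) = z})
      = P x {ω | (∀ k ≤ n, znorm (ω k - x) ≤ t) ∧ ω n = w} * srwStep (z - w) := by
  rw [hP.1.measure_inter_step x w z (measurableSet_stay_eq x w t n) (fun _ h => h.2)
    (stay_eq_congr x w t n), hP.2 w z, srwStep]

theorem IsSRW.measure_stay_eq {d : ℕ} {P : (Fin d → ℤ) → Measure (ℕ → Fin d → ℤ)}
    (hP : IsSRW d P) {t : ℝ} (ht : 0 ≤ t) (x y : Fin d → ℤ) (n : ℕ) :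
    P x {ω | (∀ k ≤ n, znorm (ω k - x) ≤ t) ∧ ω n = y} = killedLaw t n (y - x) := by
  induction n generalizing y with
  | zero =>
    simp only [killedLaw, sub_eq_zero]
    rw [← hP.1.measure_zero x y]
    refine measure_congr ?_
    filter_upwards [hP.1.ae_eq_start x] with ω hω
    refine propext ⟨fun h => h.2, fun h => ⟨fun k hk => ?_, h⟩⟩
    obtain rfl : k = 0 := by lia
    rw [hω, sub_self, znorm_zero]
    exact ht
  | succ n ih =>
    rw [killedLaw]
    split_ifs with hy
    · have hunion : {ω : ℕ → Fin d → ℤ | (∀ k ≤ n + 1, znorm (ω k - x) ≤ t) ∧ ω (n + 1) = y}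
          = ⋃ w, ({ω | (∀ k ≤ n, znorm (ω k - x) ≤ t) ∧ ω n = w} ∩ {ω | ω (n + 1) = y}) := by
        ext ω
        simp only [Set.mem_ofPred_eq, Set.mem_iUnion, Set.mem_inter_iff]
        constructor
        · rintro ⟨h, hω⟩
          exact ⟨ω n, ⟨fun k hk => h k (by lia), rfl⟩, hω⟩
        · rintro ⟨w, ⟨h, -⟩, hω⟩
          refine ⟨fun k hk => ?_, hω⟩
          rcases Nat.le_succ_iff.1 hk with hk | rfl
          · exact h k hk
          · rw [hω]; exact hy
      rw [hunion, measure_iUnion,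
        ← (Equiv.subRight x).tsum_eq fun w => killedLaw t n w * srwStep (y - x - w)]
      · refine tsum_congr fun w => ?_
        rw [hP.measure_stay_inter, ih, Equiv.subRight_apply, sub_sub_sub_cancel_right]
      · intro w w' hw
        refine Set.disjoint_left.2 fun ω h h' => hw ?_
        exact h.1.2.symm.trans h'.1.2
      · exact fun w => (measurableSet_stay_eq x w t n).inter (measurableSet_path_eq _ y)
    · convert measure_empty (μ := P x)
      refine Set.eq_empty_of_forall_notMem fun ω h => hy ?_
      rw [← h.2]
      exact h.1 _ le_rfl

theorem IsSRW.measure_exit {d : ℕ} {P : (Fin d → ℤ) → Measure (ℕ → Fin d → ℤ)}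
    (hP : IsSRW d P) {t : ℝ} (ht : 0 ≤ t) (x z : Fin d → ℤ) :
    P x {ω | ∃ n : ℕ, ω n = z ∧ (∀ k < n, znorm (ω k - x) ≤ t) ∧ t < znorm (ω n - x)}
      = exitLaw t (z - x) := by
  rw [exitLaw]
  split_ifs with hz
  swap
  · convert measure_empty (μ := P x)
    refine Set.eq_empty_of_forall_notMem ?_
    rintro ω ⟨n, hn, -, h⟩
    exact hz (hn ▸ h)
  have hunion : {ω : ℕ → Fin d → ℤ |
      ∃ n : ℕ, ω n = z ∧ (∀ k < n, znorm (ω k - x) ≤ t) ∧ t < znorm (ω n - x)}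
      =ᵐ[P x] ⋃ p : ℕ × (Fin d → ℤ), ({ω | (∀ k ≤ p.1, znorm (ω k - x) ≤ t) ∧ ω p.1 = p.2}
        ∩ {ω | ω (p.1 + 1) = z}) := by
    filter_upwards [hP.1.ae_eq_start x] with ω hω
    refine propext (Iff.trans ?_ Set.mem_iUnion.symm)
    constructor
    · rintro ⟨n, hn, hlt, hout⟩
      rcases n with _ | n
      · rw [hω, sub_self, znorm_zero] at hout
        linarith
      · exact ⟨(n, ω n), ⟨fun k hk => hlt k (by lia), rfl⟩, hn⟩
    · rintro ⟨⟨n, w⟩, ⟨h, -⟩, hn⟩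
      refine ⟨n + 1, hn, fun k hk => h k (by lia), ?_⟩
      have hn' : ω (n + 1) = z := hn
      rw [hn']
      exact hz
  rw [measure_congr hunion, measure_iUnion, ENNReal.tsum_prod']
  · refine tsum_congr fun n => ?_
    rw [← (Equiv.subRight x).tsum_eq fun w => killedLaw t n w * srwStep (z - x - w)]
    refine tsum_congr fun w => ?_
    rw [hP.measure_stay_inter, hP.measure_stay_eq ht, Equiv.subRight_apply,
      sub_sub_sub_cancel_right]
  · have hle : ∀ {n n' : ℕ} {ω : ℕ → Fin d → ℤ}, ω (n + 1) = z →
        (∀ k ≤ n', znorm (ω k - x) ≤ t) → n' ≤ n := fun {n n' ω} h h' => by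
      by_contra! hlt
      have := h' (n + 1) hlt
      rw [h] at this
      linarith
    rintro ⟨n, w⟩ ⟨n', w'⟩ hne
    refine Set.disjoint_left.2 fun ω h h' => hne ?_
    obtain ⟨⟨h1, h2⟩, h3⟩ := h
    obtain ⟨⟨h1', h2'⟩, h3'⟩ := h'
    obtain rfl : n = n' := le_antisymm (hle h3' h1) (hle h3 h1')
    exact Prod.ext rfl (h2.symm.trans h2')
  · exact fun p => (measurableSet_stay_eq x p.2 t p.1).inter (measurableSet_path_eq _ z)

theorem tsum_mul_exp_le {d : ℕ} {k : (Fin d → ℤ) → ENNReal} {L : ℝ}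
    (hsymm : ∀ z, k (-z) = k z) (hsupp : ∀ z, k z ≠ 0 → znorm z ≤ L) (hsum : ∑' z, k z ≤ 1)
    (s : ℝ) (x : Fin d → ℤ) :
    ∑' z, k z * ENNReal.ofReal (Real.exp (s * ∑ i, (x i : ℝ) * z i))
      ≤ ENNReal.ofReal (Real.exp ((s * znorm x * L) ^ 2 / 2)) := by
  set S := ∑' z, k z * ENNReal.ofReal (Real.exp (s * ∑ i, (x i : ℝ) * z i)) with hS
  have hneg : S = ∑' z, k z * ENNReal.ofReal (Real.exp (-(s * ∑ i, (x i : ℝ) * z i))) := by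
    rw [hS, ← (Equiv.neg (Fin d → ℤ)).tsum_eq]
    refine tsum_congr fun z => ?_
    simp [hsymm]
  have hpt : ∀ z, k z * ENNReal.ofReal (Real.exp (s * ∑ i, (x i : ℝ) * z i))
      + k z * ENNReal.ofReal (Real.exp (-(s * ∑ i, (x i : ℝ) * z i)))
      ≤ k z * (2 * ENNReal.ofReal (Real.exp ((s * znorm x * L) ^ 2 / 2))) := by
    intro z
    by_cases hz : k z = 0
    · simp [hz]
    rw [← mul_add, ← ENNReal.ofReal_add (Real.exp_pos _).le (Real.exp_pos _).le,
      ← ENNReal.ofReal_ofNat 2, ← ENNReal.ofReal_mul (by norm_num)]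
    refine mul_le_mul_right (ENNReal.ofReal_le_ofReal ?_) _
    have hcosh := Real.cosh_le_exp_half_sq (s * ∑ i, (x i : ℝ) * z i)
    rw [Real.cosh_eq] at hcosh
    have hdot : |∑ i, (x i : ℝ) * z i| ≤ znorm x * L := by
      have hb : znorm x * znorm z ≤ znorm x * L :=
        mul_le_mul_of_nonneg_left (hsupp z hz) (znorm_nonneg x)
      refine abs_le.2 ⟨?_, (sum_mul_le_znorm_mul x z).trans hb⟩
      have := sum_mul_le_znorm_mul (-x) z
      rw [znorm_neg] at this
      simp only [Pi.neg_apply, Int.cast_neg, neg_mul, Finset.sum_neg_distrib] at this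
      linarith
    have hsq : (s * ∑ i, (x i : ℝ) * z i) ^ 2 ≤ (s * znorm x * L) ^ 2 := by
      rw [mul_assoc, mul_pow, mul_pow s]
      refine mul_le_mul_of_nonneg_left ?_ (sq_nonneg s)
      rw [← sq_abs]
      exact pow_le_pow_left₀ (abs_nonneg _) hdot 2
    have hexp : Real.exp ((s * ∑ i, (x i : ℝ) * z i) ^ 2 / 2)
        ≤ Real.exp ((s * znorm x * L) ^ 2 / 2) := Real.exp_le_exp.2 (by linarith)
    linarith
  have h2 : 2 * S ≤ 2 * ENNReal.ofReal (Real.exp ((s * znorm x * L) ^ 2 / 2)) := by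
    calc 2 * S = S + S := two_mul S
      _ = ∑' z, (k z * ENNReal.ofReal (Real.exp (s * ∑ i, (x i : ℝ) * z i))
          + k z * ENNReal.ofReal (Real.exp (-(s * ∑ i, (x i : ℝ) * z i)))) := by
        rw [ENNReal.tsum_add, ← hneg]
      _ ≤ ∑' z, k z * (2 * ENNReal.ofReal (Real.exp ((s * znorm x * L) ^ 2 / 2))) :=
        ENNReal.tsum_le_tsum hpt
      _ ≤ _ := by
        rw [ENNReal.tsum_mul_right]
        exact mul_le_of_le_one_left zero_le hsum
  exact (ENNReal.mul_le_mul_iff_right two_ne_zero ENNReal.ofNat_ne_top).1 h2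

theorem tsum_convolution_mul_exp_le {d : ℕ} {k : (Fin d → ℤ) → ENNReal} {L : ℝ}
    (hsymm : ∀ z, k (-z) = k z) (hsupp : ∀ z, k z ≠ 0 → znorm z ≤ L) (hsum : ∑' z, k z ≤ 1)
    {a : ℕ → (Fin d → ℤ) → ENNReal} (ha0 : ∀ y, a 0 y = if y = 0 then 1 else 0)
    (ha : ∀ n y, a (n + 1) y = ∑' w, a n w * k (y - w)) (s : ℝ) (x : Fin d → ℤ) (n : ℕ) :
    ∑' y, a n y * ENNReal.ofReal (Real.exp (s * ∑ i, (x i : ℝ) * y i))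
      ≤ ENNReal.ofReal (Real.exp (n * ((s * znorm x * L) ^ 2 / 2))) := by
  induction n with
  | zero =>
    rw [tsum_eq_single 0 fun y hy => by simp [ha0, hy]]
    simp [ha0]
  | succ n ih =>
    calc ∑' y, a (n + 1) y * ENNReal.ofReal (Real.exp (s * ∑ i, (x i : ℝ) * y i))
        = ∑' w, ∑' y, a n w * k (y - w)
            * ENNReal.ofReal (Real.exp (s * ∑ i, (x i : ℝ) * y i)) := by
          rw [ENNReal.tsum_comm]
          exact tsum_congr fun y => by rw [ha, ENNReal.tsum_mul_right]
      _ = ∑' w, a n w * ENNReal.ofReal (Real.exp (s * ∑ i, (x i : ℝ) * w i)) *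
            ∑' z, k z * ENNReal.ofReal (Real.exp (s * ∑ i, (x i : ℝ) * z i)) := by
          refine tsum_congr fun w => ?_
          rw [← ENNReal.tsum_mul_left, ← (Equiv.addRight w).tsum_eq]
          refine tsum_congr fun z => ?_
          have e : s * ∑ i, (x i : ℝ) * ((z + w) i : ℤ)
              = s * ∑ i, (x i : ℝ) * w i + s * ∑ i, (x i : ℝ) * z i := by
            rw [← mul_add, ← Finset.sum_add_distrib]
            congr 1
            exact Finset.sum_congr rfl fun i _ => by push_cast [Pi.add_apply]; ring
          rw [Equiv.coe_addRight, add_sub_cancel_right, e, Real.exp_add,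
            ENNReal.ofReal_mul (Real.exp_pos _).le]
          ring
      _ ≤ ENNReal.ofReal (Real.exp (n * ((s * znorm x * L) ^ 2 / 2)))
            * ENNReal.ofReal (Real.exp ((s * znorm x * L) ^ 2 / 2)) := by
          rw [ENNReal.tsum_mul_right]
          exact mul_le_mul' ih (tsum_mul_exp_le hsymm hsupp hsum s x)
      _ = _ := by
          rw [← ENNReal.ofReal_mul (Real.exp_pos _).le, ← Real.exp_add]
          congr 2
          push_cast
          ring

theorem convolution_power_le_gaussian {d : ℕ} {k : (Fin d → ℤ) → ENNReal} {L M : ℝ} (hL : 0 < L)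
    (hsymm : ∀ z, k (-z) = k z) (hsupp : ∀ z, k z ≠ 0 → znorm z ≤ L) (hsum : ∑' z, k z ≤ 1)
    (hM : ∀ z, k z ≤ ENNReal.ofReal M) (hM0 : 0 ≤ M)
    {a : ℕ → (Fin d → ℤ) → ENNReal} (ha0 : ∀ y, a 0 y = if y = 0 then 1 else 0)
    (ha : ∀ n y, a (n + 1) y = ∑' w, a n w * k (y - w)) (n : ℕ) (x : Fin d → ℤ) :
    a (n + 1) x
      ≤ ENNReal.ofReal (M * (Real.exp 1 * Real.exp (-znorm x ^ 2 / (4 * (n + 1) * L ^ 2)))) := by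
  set r := znorm x with hr
  set s : ℝ := 1 / ((n + 1) * L ^ 2) with hs
  have hs0 : 0 < s := by positivity
  have hpt : ∀ w, a n w * k (x - w) ≤ ENNReal.ofReal (M * Real.exp (s * (r * L - r ^ 2)))
      * (a n w * ENNReal.ofReal (Real.exp (s * ∑ i, (x i : ℝ) * w i))) := by
    intro w
    by_cases hk : k (x - w) = 0
    · simp [hk]
    have hdot : r ^ 2 - r * L ≤ ∑ i, (x i : ℝ) * w i := by
      have h1 := sum_mul_le_znorm_mul x (x - w)
      have h2 : r * znorm (x - w) ≤ r * L :=
        mul_le_mul_of_nonneg_left (hsupp _ hk) (znorm_nonneg x)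
      have h3 : ∑ i, (x i : ℝ) * ((x - w) i : ℤ) = r ^ 2 - ∑ i, (x i : ℝ) * w i := by
        rw [hr, sq_znorm, ← Finset.sum_sub_distrib]
        exact Finset.sum_congr rfl fun i _ => by push_cast [Pi.sub_apply]; ring
      linarith
    have hone : M ≤ M * Real.exp (s * (r * L - r ^ 2)) * Real.exp (s * ∑ i, (x i : ℝ) * w i) := by
      rw [mul_assoc, ← Real.exp_add, ← mul_add]
      refine le_mul_of_one_le_right hM0 (Real.one_le_exp (mul_nonneg hs0.le (by linarith)))
    calc a n w * k (x - w) ≤ a n w * ENNReal.ofReal (M * Real.exp (s * (r * L - r ^ 2))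
            * Real.exp (s * ∑ i, (x i : ℝ) * w i)) :=
          mul_le_mul_right ((hM _).trans (ENNReal.ofReal_le_ofReal hone)) _
      _ = _ := by rw [ENNReal.ofReal_mul (by positivity)]; ring
  rw [ha]
  refine (ENNReal.tsum_le_tsum hpt).trans ?_
  rw [ENNReal.tsum_mul_left]
  refine (mul_le_mul_right (tsum_convolution_mul_exp_le hsymm hsupp hsum ha0 ha s x n) _).trans ?_
  rw [← ENNReal.ofReal_mul (by positivity), mul_assoc, ← Real.exp_add, ← Real.exp_add]
  refine ENNReal.ofReal_le_ofReal (mul_le_mul_of_nonneg_left (Real.exp_le_exp.2 ?_) hM0)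
  have hN : (1 : ℝ) ≤ n + 1 := by linarith [(Nat.cast_nonneg n : (0 : ℝ) ≤ n)]
  set N : ℝ := n + 1 with hNdef
  have hn : (n : ℝ) = N - 1 := by rw [hNdef]; ring
  set ρ := r / L with hρ
  have hrρ : r = ρ * L := by rw [hρ]; field_simp
  have e1 : s * (r * L - r ^ 2) = (ρ - ρ ^ 2) / N := by rw [hs, hrρ]; field_simp
  have e2 : n * ((s * r * L) ^ 2 / 2) = (1 - 1 / N) * (ρ ^ 2 / 2 / N) := by
    rw [hs, hrρ, hn]; field_simp
  have e3 : -r ^ 2 / (4 * N * L ^ 2) = -(ρ ^ 2 / 4) / N := by rw [hrρ]; field_simp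
  rw [e1, e2, e3]
  have h1 : (1 - 1 / N) * (ρ ^ 2 / 2 / N) ≤ ρ ^ 2 / 2 / N :=
    mul_le_of_le_one_left (by positivity) (by linarith [show 0 ≤ 1 / N by positivity])
  have h2 : 1 / N ≤ 1 := by rw [div_le_one (by linarith)]; exact hN
  have h3 : (ρ - ρ ^ 2) / N + ρ ^ 2 / 2 / N ≤ 1 / N + -(ρ ^ 2 / 4) / N := by
    rw [← add_div, ← add_div, div_le_div_iff_of_pos_right (by linarith)]
    nlinarith [sq_nonneg (ρ / 2 - 1)]
  linarith

theorem exists_averaged_exitLaw_le {d : ℕ} (hd : 3 ≤ d) {φ : ℝ → ℝ} (hφcont : Continuous φ)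
    (hφpos : ∀ t, 0 ≤ φ t) (hφsupp : Function.support φ ⊆ Set.Ioo 1 2) :
    ∃ C > (0 : ℝ), ∀ m : ℝ, 1 ≤ m → ∀ z : Fin d → ℤ,
      1 / m * ∫ t : ℝ, φ (t / m) * (exitLaw t z).toReal ≤ C * m ^ (-(d : ℝ)) := by
  obtain ⟨C, hC, hexit⟩ := exists_exitLaw_le hd
  have hd' : (3 : ℝ) ≤ d := by exact_mod_cast hd
  have hcomp : HasCompactSupport φ := HasCompactSupport.intro isCompact_Icc fun t ht => by
    by_contra h
    exact ht (Set.Ioo_subset_Icc_self (hφsupp h))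
  obtain ⟨B, hB⟩ := hcomp.exists_bound_of_continuous hφcont
  have hB0 : 0 ≤ B := (norm_nonneg _).trans (hB 0)
  refine ⟨(B + 1) * C, by positivity, fun m hm z => ?_⟩
  have hm0 : 0 < m := by linarith
  have hle : ∫ t : ℝ, φ (t / m) * (exitLaw t z).toReal
      ≤ ∫ t : ℝ, (Set.Icc (znorm z - 1) (znorm z)).indicator
          (fun _ => B * (C * m ^ (1 - (d : ℝ)))) t := by
    refine integral_mono_of_nonneg
      (.of_forall fun t => mul_nonneg (hφpos _) ENNReal.toReal_nonneg)
      ((integrable_indicator_iff measurableSet_Icc).2 (integrableOn_const (by simp)))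
      (.of_forall fun t => ?_)
    have hind : 0 ≤ (Set.Icc (znorm z - 1) (znorm z)).indicator
        (fun _ => B * (C * m ^ (1 - (d : ℝ)))) t :=
      Set.indicator_nonneg (fun _ _ => by positivity) _
    by_cases hφt : φ (t / m) = 0
    · simpa [hφt] using hind
    have hmt : m < t := (one_lt_div hm0).1 (hφsupp hφt).1
    by_cases hz : t < znorm z ∧ znorm z ≤ t + 1
    · rw [Set.indicator_of_mem (Set.mem_Icc.2 ⟨by linarith, hz.1.le⟩)]
      have hexit' : (exitLaw t z).toReal ≤ C * m ^ (1 - (d : ℝ)) := by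
        have h1 := ENNReal.toReal_mono ENNReal.ofReal_ne_top (hexit t (by linarith) z)
        have ht0 : 0 < t := by linarith
        rw [ENNReal.toReal_ofReal (by positivity)] at h1
        refine h1.trans (mul_le_mul_of_nonneg_left ?_ hC.le)
        exact Real.rpow_le_rpow_of_nonpos hm0 hmt.le (by linarith)
      exact mul_le_mul ((le_abs_self _).trans (hB _)) hexit' ENNReal.toReal_nonneg hB0
    · simpa [exitLaw_eq_zero (by linarith) hz] using hind
  have hint : ∫ t : ℝ, (Set.Icc (znorm z - 1) (znorm z)).indicator
      (fun _ => B * (C * m ^ (1 - (d : ℝ)))) t = B * (C * m ^ (1 - (d : ℝ))) := by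
    rw [integral_indicator_const _ measurableSet_Icc]
    simp
  have hpow : 1 / m * m ^ (1 - (d : ℝ)) = m ^ (-(d : ℝ)) := by
    rw [sub_eq_add_neg, Real.rpow_add hm0, Real.rpow_one]
    field_simp
  calc _ ≤ 1 / m * (B * (C * m ^ (1 - (d : ℝ)))) := by
        rw [hint] at hle
        gcongr
    _ = B * C * (1 / m * m ^ (1 - (d : ℝ))) := by ring
    _ ≤ _ := by
        rw [hpow]
        gcongr
        linarith

theorem averaged_exitLaw_eq_zero {d : ℕ} {φ : ℝ → ℝ}
    (hφsupp : Function.support φ ⊆ Set.Ioo 1 2) {m : ℝ} (hm : 1 ≤ m) {z : Fin d → ℤ}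
    (hz : 3 * m < znorm z) :
    ∫ t : ℝ, φ (t / m) * (exitLaw t z).toReal = 0 := by
  have hm0 : 0 < m := by linarith
  rw [← integral_zero ℝ ℝ]
  refine integral_congr_ae (.of_forall fun t => ?_)
  by_cases hφt : φ (t / m) = 0
  · simp [hφt]
  have hmt : m < t := (one_lt_div hm0).1 (hφsupp hφt).1
  have htm : t < 2 * m := (div_lt_iff₀ hm0).1 (hφsupp hφt).2
  simp [exitLaw_eq_zero (show 0 ≤ t by linarith) (z := z) fun h => by linarith [h.2]]

/-- Fix `d ≥ 3` and a smooth probability density `φ` supported in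
`(1,2)`. There are constants `c₁, c₂ > 0` (depending only on `d`) such that for every
`m ≥ 1`, if `π̂_m` is the coarse-grained kernel whose one-step law from `x` is the
`φ`-average over `t` of the exit distribution of simple random walk from the ball
`V_t(x)`, then its `n`-step transition probabilities satisfy, for `n ≥ 1` and
`|x| ≥ 3m`, `π̂_m^n(0,x) ≤ c₁ m^{-d} exp(-|x|²/(c₂ n m²))`. -/
theorem stmt7 (d : ℕ) (hd : 3 ≤ d) (φ : ℝ → ℝ)
    (hφsmooth : ContDiff ℝ (⊤ : ℕ∞) φ) (hφpos : ∀ t, 0 ≤ φ t)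
    (hφsupp : Function.support φ ⊆ Set.Ioo 1 2)
    (hφint : ∫ t, φ t = 1) :
    ∃ c1 > (0 : ℝ), ∃ c2 > (0 : ℝ), ∀ m : ℝ, 1 ≤ m →
      ∀ Psrw : (Fin d → ℤ) → Measure (ℕ → Fin d → ℤ), IsSRW d Psrw →
      ∀ Pcg : (Fin d → ℤ) → Measure (ℕ → Fin d → ℤ), IsMarkovChain Pcg →
      (∀ x z : Fin d → ℤ,
        (Pcg x {ω | ω 1 = z}).toReal
          = (1 / m) * ∫ t : ℝ, φ (t / m) *
              (Psrw x {ω | ∃ n : ℕ, ω n = z ∧ (∀ k < n, znorm (ω k - x) ≤ t)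
                ∧ t < znorm (ω n - x)}).toReal) →
      ∀ n : ℕ, 1 ≤ n → ∀ x : Fin d → ℤ, 3 * m ≤ znorm x →
        Pcg 0 {ω | ω n = x}
          ≤ ENNReal.ofReal (c1 * m ^ (-(d : ℝ))
              * Real.exp (-(znorm x) ^ 2 / (c2 * n * m ^ 2))) := by
  obtain ⟨C, hC, hK⟩ := exists_averaged_exitLaw_le hd hφsmooth.continuous hφpos hφsupp
  refine ⟨C * Real.exp 1, by positivity, 36, by norm_num, ?_⟩
  intro m hm Psrw hsrw Pcg hcg hstep n hn x _
  have hm0 : 0 < m := by linarith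
  set k : (Fin d → ℤ) → ENNReal := fun z =>
    ENNReal.ofReal (1 / m * ∫ t : ℝ, φ (t / m) * (exitLaw t z).toReal) with hk
  have hkstep : ∀ w z, Pcg w {ω | ω 1 = z} = k (z - w) := by
    intro w z
    have := hcg.1 w
    rw [← ENNReal.ofReal_toReal (measure_ne_top (Pcg w) {ω | ω 1 = z}), hstep, hk]
    congr 2
    refine integral_congr_ae (.of_forall fun t => ?_)
    by_cases hφt : φ (t / m) = 0
    · simp [hφt]
    have hmt : m < t := (one_lt_div hm0).1 (hφsupp hφt).1
    simp only [hsrw.measure_exit (show 0 ≤ t by linarith)]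
  have hsum : ∑' z, k z ≤ 1 := by
    have := hcg.1 0
    have hunion : (Set.univ : Set (ℕ → Fin d → ℤ)) = ⋃ z, {ω | ω 1 = z} := by ext; simp
    rw [← measure_univ (μ := Pcg 0), hunion, measure_iUnion]
    · simp [hkstep]
    · exact fun z z' hz => Set.disjoint_left.2 fun ω h h' => hz (h.symm.trans h')
    · exact fun z => measurableSet_path_eq 1 z
  obtain ⟨n, rfl⟩ := Nat.exists_eq_add_of_le' hn
  have hmain := convolution_power_le_gaussian (k := k) (L := 3 * m) (M := C * m ^ (-(d : ℝ)))
    (a := fun n y => Pcg 0 {ω | ω n = y}) (by positivity)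
    (fun z => by simp only [hk, exitLaw_neg])
    (fun z hz => by
      by_contra! h
      exact hz (by simp [hk, averaged_exitLaw_eq_zero hφsupp hm h]))
    hsum (fun z => ENNReal.ofReal_le_ofReal (hK m hm z)) (by positivity)
    (fun y => hcg.measure_zero 0 y)
    (fun n y => by simp only [hcg.measure_succ 0 y n, hkstep]) n x
  refine hmain.trans_eq ?_
  congr 1
  push_cast
  rw [show 4 * ((n : ℝ) + 1) * (3 * m) ^ 2 = 36 * (n + 1) * m ^ 2 by ring]
  ring
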